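/- Let τ be the K-algebra automorphism of P = K[x_1, x_2, x_3, x_4, x_5] with τ(x_1) = x_1 and τ(x_i) = x_i + x_{i−1} for i = 2, …, 5, and let F = P^τ be the fixed algebra. With p_1 = x_2² − x_1(x_2 + 2x_3), q_1 = −x_2³ + 3x_1x_2x_3 + x_1²x_2 − 3x_1²x_4, p_2 = x_3² − x_2(x_3 + 2x_4) + x_1(x_3 + 3x_4 + 2x_5), and t = 6x_2²x_5 − 6x_2(x_3 − x_2)x_4 + 2x_3³ − x_2x_3(3x_3 − x_2) + x_1(−6(x_2 + 2x_3)x_5 + 9x_4² − 6x_2x_4 + 2x_3² − x_2x_3), the following hold: (i) x_1, p_1, q_1, p_2, t are τ-invariant and generate F as a K-algebra; (ii) the relation x_1³t = q_1² − p_1³ + 3x_1p_1q_1 + 2x_1²p_1² + 3x_1²p_1p_2 holds in P; (iii) the monomials x_1^{a} p_1^{b} p_2^{c} t^{d} q_1^{e} with a, b, c, d ≥ 0 and e ∈ {0, 1} form a K-vector-space basis of F (so the relation in (ii) is a defining relation for F). -/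

import Mathlib

noncomputable section

open MvPolynomial

variable (K : Type*) [Field K] [CharZero K]

/-- `p_1 = x_2² − x_1(x_2 + 2x_3)` (variables `x_1,…,x_5` are `X 0, …, X 4`). -/
def p1 : MvPolynomial (Fin 5) K := X 1 ^ 2 - X 0 * (X 1 + 2 * X 2)

/-- `q_1 = −x_2³ + 3x_1x_2x_3 + x_1²x_2 − 3x_1²x_4`. -/
def q1 : MvPolynomial (Fin 5) K :=
  -(X 1 ^ 3) + 3 * X 0 * X 1 * X 2 + X 0 ^ 2 * X 1 - 3 * X 0 ^ 2 * X 3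

/-- `p_2 = x_3² − x_2(x_3 + 2x_4) + x_1(x_3 + 3x_4 + 2x_5)`. -/
def p2 : MvPolynomial (Fin 5) K :=
  X 2 ^ 2 - X 1 * (X 2 + 2 * X 3) + X 0 * (X 2 + 3 * X 3 + 2 * X 4)

/-- `t = 6x_2²x_5 − 6x_2(x_3 − x_2)x_4 + 2x_3³ − x_2x_3(3x_3 − x_2)
  + x_1(−6(x_2 + 2x_3)x_5 + 9x_4² − 6x_2x_4 + 2x_3² − x_2x_3)`. -/
def tInv : MvPolynomial (Fin 5) K :=
  6 * X 1 ^ 2 * X 4 - 6 * X 1 * (X 2 - X 1) * X 3 + 2 * X 2 ^ 3 - X 1 * X 2 * (3 * X 2 - X 1)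
    + X 0 * (-6 * (X 1 + 2 * X 2) * X 4 + 9 * X 3 ^ 2 - 6 * X 1 * X 3
        + 2 * X 2 ^ 2 - X 1 * X 2)

set_option linter.unusedSectionVars false

/-- The monomial `x_1^a p_1^b p_2^c t^d q_1^e` attached to the exponents `(a, b, c, d, e)`. -/
def normalMonomial (w : ℕ × ℕ × ℕ × ℕ × Fin 2) : MvPolynomial (Fin 5) K :=
  X 0 ^ w.1 * p1 K ^ w.2.1 * p2 K ^ w.2.2.1 * tInv K ^ w.2.2.2.1 * q1 K ^ (w.2.2.2.2 : ℕ)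

/-- The specialization `x_1 = x_3 = 0`, `x_5 ↦ x_5 - x_4`, which sends `x_1` to zero and
`p_1, p_2, t, q_1` to nonzero multiples of monomials. -/
def specialization : MvPolynomial (Fin 5) K →ₐ[K] MvPolynomial (Fin 5) K :=
  aeval ![0, X 1, 0, X 3, X 4 - X 3]

/-- The exponent vector of the image under `specialization` of the normal monomial with
exponents `(0, b, c, d, e)`. -/
def imageExponent (u : ℕ × ℕ × ℕ × Fin 2) : Fin 5 →₀ ℕ :=
  Finsupp.single 1 (2 * u.1 + u.2.1 + 2 * u.2.2.1 + 3 * (u.2.2.2 : ℕ))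
    + Finsupp.single 3 u.2.1 + Finsupp.single 4 u.2.2.1

/-- The coefficient of the image under `specialization` of the normal monomial with
exponents `(0, b, c, d, e)`. -/
def imageCoeff (u : ℕ × ℕ × ℕ × Fin 2) : K :=
  (-2) ^ u.2.1 * 6 ^ u.2.2.1 * (-1) ^ (u.2.2.2 : ℕ)

/-- The algebra generated by `x_1, p_1, q_1, p_2, t`. -/
abbrev generatedAlgebra : Subalgebra K (MvPolynomial (Fin 5) K) :=
  Algebra.adjoin K ({X 0, p1 K, q1 K, p2 K, tInv K} : Set (MvPolynomial (Fin 5) K))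

theorem X_pow_three_mul_tInv :
    X 0 ^ 3 * tInv K
      = q1 K ^ 2 - p1 K ^ 3 + 3 * X 0 * p1 K * q1 K + 2 * X 0 ^ 2 * p1 K ^ 2
          + 3 * X 0 ^ 2 * p1 K * p2 K := by
  simp only [tInv, q1, p1, p2]
  ring

theorem imageExponent_injective : Function.Injective imageExponent := by
  rintro ⟨b, c, d, e⟩ ⟨b', c', d', e'⟩ h
  have h1 := DFunLike.congr_fun h 1
  have h3 := DFunLike.congr_fun h 3
  have h4 := DFunLike.congr_fun h 4
  simp [imageExponent] at h1 h3 h4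
  have he : e = e' := by ext; omega
  subst he
  simp only [Prod.mk.injEq, and_true]
  omega

theorem imageCoeff_ne_zero (u : ℕ × ℕ × ℕ × Fin 2) : imageCoeff K u ≠ 0 := by
  simp [imageCoeff]

theorem specialization_X_zero : specialization K (X 0) = 0 := by
  simp [specialization]

theorem specialization_normalMonomial_zero (u : ℕ × ℕ × ℕ × Fin 2) :
    specialization K (normalMonomial K (0, u)) = monomial (imageExponent u) (imageCoeff K u) := by
  have hp1 : specialization K (p1 K) = X 1 ^ 2 := by simp [specialization, p1]
  have hq1 : specialization K (q1 K) = -X 1 ^ 3 := by simp [specialization, q1]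
  have hp2 : specialization K (p2 K) = -2 * (X 1 * X 3) := by
    simp only [specialization, p2, map_add, map_sub, map_mul, map_pow, map_ofNat, aeval_X]
    simp; ring
  have ht : specialization K (tInv K) = 6 * (X 1 ^ 2 * X 4) := by
    simp only [specialization, tInv, map_add, map_sub, map_neg, map_mul, map_pow, map_ofNat,
      aeval_X]
    simp; ring
  obtain ⟨b, c, d, e⟩ := u
  have hC : (C (imageCoeff K (b, c, d, e)) : MvPolynomial (Fin 5) K)
      = (-2) ^ c * 6 ^ d * (-1) ^ (e : ℕ) := by
    simp only [imageCoeff, map_mul, map_pow, map_neg, map_ofNat, map_one]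
  rw [← mul_one (imageCoeff K _), ← C_mul_monomial, hC, imageExponent]
  simp only [normalMonomial, map_mul, map_pow, hp1, hq1, hp2, ht, specialization_X_zero]
  rw [show ∀ i j k : ℕ, monomial (Finsupp.single 1 i + Finsupp.single 3 j + Finsupp.single 4 k)
    (1 : K) = (X 1 ^ i * X 3 ^ j * X 4 ^ k : MvPolynomial (Fin 5) K) by
      intro i j k; simp [X_pow_eq_monomial, monomial_mul]]
  rw [neg_pow ((X 1 : MvPolynomial (Fin 5) K) ^ 3)]
  ring

theorem specialization_normalMonomial_succ (a : ℕ) (u : ℕ × ℕ × ℕ × Fin 2) :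
    specialization K (normalMonomial K (a + 1, u)) = 0 := by
  simp [normalMonomial, specialization_X_zero]

theorem normalMonomial_add (n a : ℕ) (u : ℕ × ℕ × ℕ × Fin 2) :
    normalMonomial K (n + a, u) = X 0 ^ n * normalMonomial K (a, u) := by
  simp only [normalMonomial]
  ring

/-- If a combination of normal monomials vanishes at `x_1 = 0` after division by `x_1 ^ n`, its
coefficients at exponents with `a = n` vanish. -/
theorem coeff_eq_zero_of_X_dvd (g : (ℕ × ℕ × ℕ × ℕ × Fin 2) →₀ K)
    (n : ℕ) (hn : ∀ w, w.1 < n → g w = 0)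
    (h : X 0 ^ (n + 1) ∣ Finsupp.linearCombination K (normalMonomial K) g)
    (u : ℕ × ℕ × ℕ × Fin 2) : g (n, u) = 0 := by
  have hfac : Finsupp.linearCombination K (normalMonomial K) g
      = X 0 ^ n * ∑ w ∈ g.support, g w • normalMonomial K (w.1 - n, w.2) := by
    rw [Finsupp.linearCombination_apply, Finsupp.sum, Finset.mul_sum]
    refine Finset.sum_congr rfl fun w hw => ?_
    have hle : n ≤ w.1 := by
      by_contra! hlt
      exact Finsupp.mem_support_iff.mp hw (hn w hlt)
    rw [mul_smul_comm, ← normalMonomial_add, Nat.add_sub_cancel' hle]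
  rw [hfac, pow_succ] at h
  obtain ⟨r, hr⟩ := (mul_dvd_mul_iff_left (pow_ne_zero n (X_ne_zero 0))).mp h
  have hsum := congrArg (fun f => coeff (imageExponent u) (specialization K f)) hr
  simp only [map_sum, map_mul, map_smul, specialization_X_zero, zero_mul, coeff_zero,
    coeff_sum, coeff_smul, smul_eq_mul] at hsum
  rw [Finset.sum_eq_single (n, u)] at hsum
  · simpa [specialization_normalMonomial_zero, imageCoeff_ne_zero] using hsum
  · rintro ⟨a, u'⟩ hw hne
    have hle : n ≤ a := by
      by_contra! hlt
      exact Finsupp.mem_support_iff.mp hw (hn _ hlt)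
    obtain ⟨k, rfl⟩ := Nat.exists_eq_add_of_le hle
    rcases k with _ | k
    · have hu : u' ≠ u := by rintro rfl; exact hne rfl
      simp [specialization_normalMonomial_zero, coeff_monomial,
        imageExponent_injective.ne hu]
    · simp [specialization_normalMonomial_succ]
  · intro hw
    simp [Finsupp.notMem_support_iff.mp hw]

theorem linearIndependent_normalMonomial : LinearIndependent K (normalMonomial K) := by
  rw [linearIndependent_iff]
  intro g hg
  have hlt : ∀ n, ∀ w : ℕ × ℕ × ℕ × ℕ × Fin 2, w.1 < n → g w = 0 := by
    intro n
    induction n with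
    | zero => intro w hw; exact absurd hw (Nat.not_lt_zero _)
    | succ n ih =>
      rintro ⟨a, u⟩ hw
      rcases Nat.lt_succ_iff_lt_or_eq.mp hw with h | h
      · exact ih _ h
      · obtain rfl : a = n := h
        exact coeff_eq_zero_of_X_dvd K g a ih (hg ▸ dvd_zero _) u
  ext w
  exact hlt (w.1 + 1) w (Nat.lt_succ_self _)

theorem mem_span_normalMonomial_of_X_mul {f : MvPolynomial (Fin 5) K}
    (hf : X 0 * f ∈ Submodule.span K (Set.range (normalMonomial K))) :
    f ∈ Submodule.span K (Set.range (normalMonomial K)) := by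
  obtain ⟨g, hg⟩ := (Finsupp.mem_span_range_iff_exists_finsupp).mp hf
  have hzero : ∀ u, g (0, u) = 0 :=
    coeff_eq_zero_of_X_dvd K g 0 (fun w hw => absurd hw (Nat.not_lt_zero _))
      (by rw [Finsupp.linearCombination_apply, hg]; simp)
  have hfac : g.sum (fun w c => c • normalMonomial K w)
      = X 0 * ∑ w ∈ g.support, g w • normalMonomial K (w.1 - 1, w.2) := by
    rw [Finsupp.sum, Finset.mul_sum]
    refine Finset.sum_congr rfl fun w hw => ?_
    obtain ⟨_ | a, u⟩ := w
    · exact absurd (hzero u) (Finsupp.mem_support_iff.mp hw)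
    · rw [mul_smul_comm, add_comm a 1, normalMonomial_add, pow_one, Nat.add_sub_cancel_left]
  rw [hfac] at hg
  rw [← mul_left_cancel₀ (X_ne_zero 0) hg]
  exact Submodule.sum_mem _ fun w _ =>
    Submodule.smul_mem _ _ (Submodule.subset_span ⟨_, rfl⟩)

theorem q1_mul_normalMonomial_mem_span (w : ℕ × ℕ × ℕ × ℕ × Fin 2) :
    q1 K * normalMonomial K w ∈ Submodule.span K (Set.range (normalMonomial K)) := by
  have hmem : ∀ w', normalMonomial K w' ∈ Submodule.span K (Set.range (normalMonomial K)) :=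
    fun w' => Submodule.subset_span ⟨w', rfl⟩
  obtain ⟨a, b, c, d, e⟩ := w
  fin_cases e
  · convert hmem (a, b, c, d, 1) using 1
    simp [normalMonomial]
    ring
  · have hrw : q1 K * normalMonomial K (a, b, c, d, 1)
        = normalMonomial K (a + 3, b, c, d + 1, 0) + normalMonomial K (a, b + 3, c, d, 0)
          - (3 : K) • normalMonomial K (a + 1, b + 1, c, d, 1)
          - (2 : K) • normalMonomial K (a + 2, b + 2, c, d, 0)
          - (3 : K) • normalMonomial K (a + 2, b + 1, c + 1, d, 0) := by
      simp only [normalMonomial, smul_eq_C_mul, map_ofNat, Fin.val_zero, Fin.val_one]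
      linear_combination
        (-(X 0 ^ a * p1 K ^ b * p2 K ^ c * tInv K ^ d)) * X_pow_three_mul_tInv K
    change q1 K * normalMonomial K (a, b, c, d, 1) ∈ _
    rw [hrw]
    exact sub_mem (sub_mem (sub_mem (add_mem (hmem _) (hmem _))
      (Submodule.smul_mem _ _ (hmem _))) (Submodule.smul_mem _ _ (hmem _)))
      (Submodule.smul_mem _ _ (hmem _))

theorem normalMonomial_mem_generatedAlgebra (w : ℕ × ℕ × ℕ × ℕ × Fin 2) :
    normalMonomial K w ∈ generatedAlgebra K := by
  have h : ∀ x ∈ ({X 0, p1 K, q1 K, p2 K, tInv K} : Set (MvPolynomial (Fin 5) K)),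
      x ∈ generatedAlgebra K := fun x hx => Algebra.subset_adjoin hx
  refine mul_mem (mul_mem (mul_mem (mul_mem ?_ ?_) ?_) ?_) ?_ <;>
    exact pow_mem (h _ (by simp)) _

theorem span_normalMonomial :
    Submodule.span K (Set.range (normalMonomial K))
      = Subalgebra.toSubmodule (generatedAlgebra K) := by
  apply le_antisymm
  · rw [Submodule.span_le]
    rintro _ ⟨w, rfl⟩
    exact normalMonomial_mem_generatedAlgebra K w
  · rw [Algebra.adjoin_eq_span, Submodule.span_le]
    intro f hf
    have hmem : ∀ w, normalMonomial K w ∈ Submodule.span K (Set.range (normalMonomial K)) :=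
      fun w => Submodule.subset_span ⟨w, rfl⟩
    induction hf using Submonoid.closure_induction_left with
    | one => simpa [normalMonomial] using hmem 0
    | mul_left x hx y _ ih =>
      have hle : Submodule.span K (Set.range (normalMonomial K))
          ≤ (Submodule.span K (Set.range (normalMonomial K))).comap (LinearMap.mulLeft K x) := by
        rw [Submodule.span_le]
        rintro _ ⟨⟨a, b, c, d, e⟩, rfl⟩
        rw [SetLike.mem_coe, Submodule.mem_comap, LinearMap.mulLeft_apply]
        rcases hx with rfl | rfl | rfl | rfl | rfl
        · convert hmem (a + 1, b, c, d, e) using 1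
          simp only [normalMonomial]; ring
        · convert hmem (a, b + 1, c, d, e) using 1
          simp only [normalMonomial]; ring
        · exact q1_mul_normalMonomial_mem_span K _
        · convert hmem (a, b, c + 1, d, e) using 1
          simp only [normalMonomial]; ring
        · convert hmem (a, b, c, d + 1, e) using 1
          simp only [normalMonomial]; ring
      exact hle ih

/-- Up to a power of `x_1`, every polynomial is a polynomial in `x_2` over the algebra generated
by the invariants. -/
theorem exists_X_pow_mul_eq_aeval (f : MvPolynomial (Fin 5) K) :
    ∃ (n : ℕ) (Q : Polynomial (generatedAlgebra K)),
      Polynomial.aeval (X 1 : MvPolynomial (Fin 5) K) Q = X 0 ^ n * f := by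
  let R : Subalgebra K (MvPolynomial (Fin 5) K) :=
    (Polynomial.aeval (R := generatedAlgebra K)
      (X 1 : MvPolynomial (Fin 5) K)).range.restrictScalars K
  have hgen : ∀ x ∈ ({X 0, p1 K, q1 K, p2 K, tInv K} : Set (MvPolynomial (Fin 5) K)), x ∈ R :=
    fun x hx => ⟨Polynomial.C ⟨x, Algebra.subset_adjoin hx⟩, by simp⟩
  have ha : X 0 ∈ R := hgen _ (by simp)
  have hp1 : p1 K ∈ R := hgen _ (by simp)
  have hq1 : q1 K ∈ R := hgen _ (by simp)
  have hp2 : p2 K ∈ R := hgen _ (by simp)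
  have hx : X 1 ∈ R := ⟨Polynomial.X, by simp⟩
  have hinv : ∀ {c : K} {f : MvPolynomial (Fin 5) K}, c ≠ 0 → C c * f ∈ R → f ∈ R := by
    intro c f hc hf
    have := R.smul_mem hf c⁻¹
    rwa [smul_eq_C_mul, ← mul_assoc, ← C_mul, inv_mul_cancel₀ hc, C_1, one_mul] at this
  have hofNat : ∀ n : ℕ, (n : MvPolynomial (Fin 5) K) ∈ R := fun n => natCast_mem R n
  have h2 : X 0 * X 2 ∈ R := by
    refine hinv (c := 2) two_ne_zero ?_
    have h : C 2 * (X 0 * X 2) = X 1 ^ 2 - X 0 * X 1 - p1 K := by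
      simp only [p1, map_ofNat]; ring
    rw [h]
    exact sub_mem (sub_mem (pow_mem hx 2) (mul_mem ha hx)) hp1
  have h3 : X 0 ^ 2 * X 3 ∈ R := by
    refine hinv (c := 3) three_ne_zero ?_
    have h : C 3 * (X 0 ^ 2 * X 3)
        = ((3 : ℕ) : MvPolynomial (Fin 5) K) * (X 1 * (X 0 * X 2))
          + X 0 ^ 2 * X 1 - X 1 ^ 3 - q1 K := by
      simp only [q1, map_ofNat]; push_cast; ring
    rw [h]
    exact sub_mem (sub_mem (add_mem (mul_mem (hofNat 3) (mul_mem hx h2))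
      (mul_mem (pow_mem ha 2) hx)) (pow_mem hx 3)) hq1
  have h4 : X 0 ^ 3 * X 4 ∈ R := by
    refine hinv (c := 2) two_ne_zero ?_
    have h : C 2 * (X 0 ^ 3 * X 4)
        = X 0 ^ 2 * p2 K - (X 0 * X 2) ^ 2
          + X 1 * (X 0 * (X 0 * X 2) + ((2 : ℕ) : MvPolynomial (Fin 5) K) * (X 0 ^ 2 * X 3))
          - X 0 * (X 0 * (X 0 * X 2) + ((3 : ℕ) : MvPolynomial (Fin 5) K) * (X 0 ^ 2 * X 3)) := by
      simp only [p2, map_ofNat]; push_cast; ring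
    rw [h]
    exact sub_mem (add_mem (sub_mem (mul_mem (pow_mem ha 2) hp2) (pow_mem h2 2))
      (mul_mem hx (add_mem (mul_mem ha h2) (mul_mem (hofNat 2) h3))))
      (mul_mem ha (add_mem (mul_mem ha h2) (mul_mem (hofNat 3) h3)))
  have hX : ∀ i : Fin 5, X 0 ^ 3 * X i ∈ R := by
    intro i
    fin_cases i
    · exact mul_mem (pow_mem ha 3) ha
    · exact mul_mem (pow_mem ha 3) hx
    · convert mul_mem (pow_mem ha 2) h2 using 1
      simp only [Fin.reduceFinMk]; ring
    · convert mul_mem ha h3 using 1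
      simp only [Fin.reduceFinMk]; ring
    · exact h4
  suffices h : ∃ n : ℕ, X 0 ^ n * f ∈ R from h
  induction f using MvPolynomial.induction_on with
  | C c => exact ⟨0, mul_mem (pow_mem ha 0) (R.algebraMap_mem c)⟩
  | add f g hf hg =>
    obtain ⟨n, hn⟩ := hf
    obtain ⟨m, hm⟩ := hg
    refine ⟨n + m, ?_⟩
    convert add_mem (mul_mem (pow_mem ha m) hn) (mul_mem (pow_mem ha n) hm) using 1
    ring
  | mul_X f i hf =>
    obtain ⟨n, hn⟩ := hf
    refine ⟨n + 3, ?_⟩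
    convert mul_mem hn (hX i) using 1
    ring

/-- A polynomial fixed by an endomorphism that fixes `x_1` and the generating invariants and
shifts `x_2` by `x_1` lies in the generated algebra up to a power of `x_1`. -/
theorem exists_X_pow_mul_mem_generatedAlgebra
    (τ : MvPolynomial (Fin 5) K →ₐ[K] MvPolynomial (Fin 5) K)
    (hτ : ∀ f ∈ generatedAlgebra K, τ f = f) (hτ1 : τ (X 1) = X 1 + X 0)
    {f : MvPolynomial (Fin 5) K} (hf : τ f = f) :
    ∃ n : ℕ, X 0 ^ n * f ∈ generatedAlgebra K := by
  obtain ⟨n, Q, hQ⟩ := exists_X_pow_mul_eq_aeval K f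
  refine ⟨n, ?_⟩
  have hτ0 : τ (X 0) = X 0 := hτ _ (Algebra.subset_adjoin (by simp))
  have hcoeff : ((Q.map (algebraMap (generatedAlgebra K) (MvPolynomial (Fin 5) K))).map
      (τ : MvPolynomial (Fin 5) K →+* MvPolynomial (Fin 5) K))
      = Q.map (algebraMap (generatedAlgebra K) (MvPolynomial (Fin 5) K)) := by
    ext1 k
    simpa using hτ _ (Q.coeff k).2
  have hshift : ∀ k : ℕ, (Q.map (algebraMap (generatedAlgebra K) (MvPolynomial (Fin 5) K))).eval
      (X 1 + (k : MvPolynomial (Fin 5) K) * X 0) = X 0 ^ n * f := by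
    intro k
    induction k with
    | zero => simpa [Polynomial.eval_map_algebraMap] using hQ
    | succ k ih =>
      have h := congrArg τ ih
      rw [map_mul, map_pow, hτ0, hf] at h
      rw [← h, ← RingHom.coe_coe τ, ← Polynomial.eval_map_apply, hcoeff]
      congr 1
      rw [RingHom.coe_coe, map_add, map_mul, map_natCast, hτ0, hτ1]
      push_cast
      ring
  have hconst : Q.map (algebraMap (generatedAlgebra K) (MvPolynomial (Fin 5) K))
      = Polynomial.C (X 0 ^ n * f) := by
    refine Polynomial.eq_of_infinite_eval_eq _ _ ?_
    refine (Set.infinite_range_of_injective (f := fun k : ℕ =>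
      X 1 + (k : MvPolynomial (Fin 5) K) * X 0) ?_).mono ?_
    · intro k l hkl
      have := mul_right_cancel₀ (X_ne_zero (0 : Fin 5)) (add_left_cancel hkl)
      exact_mod_cast this
    · rintro _ ⟨k, rfl⟩
      simpa using hshift k
  have h0 := congrArg (fun p => Polynomial.coeff p 0) hconst
  simp only [Polynomial.coeff_map, Polynomial.coeff_C_zero] at h0
  rw [← h0]
  exact (Q.coeff 0).2

theorem fixed_iff_mem_generatedAlgebra
    (τ : MvPolynomial (Fin 5) K →ₐ[K] MvPolynomial (Fin 5) K)
    (hτ : ∀ f ∈ generatedAlgebra K, τ f = f) (hτ1 : τ (X 1) = X 1 + X 0)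
    (f : MvPolynomial (Fin 5) K) : τ f = f ↔ f ∈ generatedAlgebra K := by
  refine ⟨fun hf => ?_, hτ f⟩
  obtain ⟨n, hn⟩ := exists_X_pow_mul_mem_generatedAlgebra K τ hτ hτ1 hf
  rw [← Subalgebra.mem_toSubmodule, ← span_normalMonomial] at hn ⊢
  induction n with
  | zero => simpa using hn
  | succ n ih =>
    rw [pow_succ', mul_assoc] at hn
    exact ih (mem_span_normalMonomial_of_X_mul K hn)

/-- The fixed algebra of `K[x_1,…,x_5]` under `τ : x_1 ↦ x_1, x_i ↦ x_i + x_{i−1}` is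
generated by `x_1, p_1, q_1, p_2, t`, subject to the defining relation
`x_1³t = q_1² − p_1³ + 3x_1p_1q_1 + 2x_1²p_1² + 3x_1²p_1p_2`; the monomials
`x_1^a p_1^b p_2^c t^d q_1^e` with `e ∈ {0,1}` form a `K`-basis. -/
theorem fixed_algebra_five_vars {K : Type*} [Field K] [CharZero K]
    (τ : MvPolynomial (Fin 5) K ≃ₐ[K] MvPolynomial (Fin 5) K)
    (h1 : τ (X 0) = X 0) (h2 : τ (X 1) = X 1 + X 0) (h3 : τ (X 2) = X 2 + X 1)
    (h4 : τ (X 3) = X 3 + X 2) (h5 : τ (X 4) = X 4 + X 3) :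
    (τ (p1 K) = p1 K ∧ τ (q1 K) = q1 K ∧ τ (p2 K) = p2 K ∧ τ (tInv K) = tInv K
      ∧ ∀ pp : MvPolynomial (Fin 5) K,
          τ pp = pp ↔
            pp ∈ Algebra.adjoin K
              ({X 0, p1 K, q1 K, p2 K, tInv K} : Set (MvPolynomial (Fin 5) K)))
    ∧ (X 0 ^ 3 * tInv K
        = q1 K ^ 2 - p1 K ^ 3 + 3 * X 0 * p1 K * q1 K + 2 * X 0 ^ 2 * p1 K ^ 2
            + 3 * X 0 ^ 2 * p1 K * p2 K)
    ∧ (LinearIndependent K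
          (fun w : ℕ × ℕ × ℕ × ℕ × Fin 2 =>
            X 0 ^ w.1 * p1 K ^ w.2.1 * p2 K ^ w.2.2.1 * tInv K ^ w.2.2.2.1
              * q1 K ^ (w.2.2.2.2 : ℕ))
        ∧ (Submodule.span K
              (Set.range fun w : ℕ × ℕ × ℕ × ℕ × Fin 2 =>
                X 0 ^ w.1 * p1 K ^ w.2.1 * p2 K ^ w.2.2.1 * tInv K ^ w.2.2.2.1
                  * q1 K ^ (w.2.2.2.2 : ℕ)) :
              Set (MvPolynomial (Fin 5) K))
            = {pp : MvPolynomial (Fin 5) K | τ pp = pp}) := by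
  have hp1 : τ (p1 K) = p1 K := by
    simp only [p1, map_add, map_sub, map_mul, map_pow, map_ofNat, h1, h2, h3]
    ring
  have hq1 : τ (q1 K) = q1 K := by
    simp only [q1, map_add, map_sub, map_neg, map_mul, map_pow, map_ofNat, h1, h2, h3, h4]
    ring
  have hp2 : τ (p2 K) = p2 K := by
    simp only [p2, map_add, map_sub, map_mul, map_pow, map_ofNat, h1, h2, h3, h4, h5]
    ring
  have ht : τ (tInv K) = tInv K := by
    simp only [tInv, map_add, map_sub, map_neg, map_mul, map_pow, map_ofNat, h1, h2, h3, h4, h5]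
    ring
  have hfix : ∀ f ∈ generatedAlgebra K, (τ : _ →ₐ[K] MvPolynomial (Fin 5) K) f = f := by
    intro f hf
    have hle : generatedAlgebra K
        ≤ AlgHom.equalizer (τ : _ →ₐ[K] MvPolynomial (Fin 5) K) (AlgHom.id K _) := by
      rw [Algebra.adjoin_le_iff]
      rintro x (rfl | rfl | rfl | rfl | rfl) <;> assumption
    exact hle hf
  have hiff := fixed_iff_mem_generatedAlgebra K (τ : _ →ₐ[K] MvPolynomial (Fin 5) K) hfix h2
  refine ⟨⟨hp1, hq1, hp2, ht, hiff⟩, X_pow_three_mul_tInv K,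
    linearIndependent_normalMonomial K, ?_⟩
  change ((Submodule.span K (Set.range (normalMonomial K)) :
    Submodule K (MvPolynomial (Fin 5) K)) : Set (MvPolynomial (Fin 5) K)) = _
  ext f
  rw [span_normalMonomial]
  exact (hiff f).symm
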